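/- Let 0 < a < b and γ > 0, and let α be a differentiable function with values in (0,1). Define x(t) = (ln(b/t))^γ for a ≤ t ≤ b (with x(b)=0). Then for every t with a ≤ t < b, the right Caputo–Hadamard fractional derivative of variable order type 3 of x at t equals Γ(γ+1)/Γ(γ+1−α(t)) · (ln(b/t))^{γ−α(t)} + (t·α'(t)·Γ(γ+1)/Γ(γ+2−α(t))) · (ln(b/t))^{γ+1−α(t)} · [ln(ln(b/t)) − ψ(γ+2−α(t))]. -/

import Mathlib

/-- The digamma function `ψ(x) = Γ'(x)/Γ(x)`. -/
noncomputable def digamma (x : ℝ) : ℝ := deriv Real.Gamma x / Real.Gamma x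

/-- The right Caputo–Hadamard fractional derivative of variable order `α(t)`, type 3. -/
noncomputable def CHD3r (b : ℝ) (α x : ℝ → ℝ) (t : ℝ) : ℝ :=
  -t * deriv (fun s : ℝ => (1 / Real.Gamma (1 - α s)) *
    ∫ τ in s..b, (Real.log (τ / s)) ^ (-(α s)) * (x τ - x b) / τ) t

theorem aux_beta (p q L : ℝ) (hp : 0 < p) (hq : 0 < q) (hL : 0 < L) :
    ∫ u in Set.Ioo 0 L, u ^ (p - 1) * (L - u) ^ (q - 1)
      = L ^ (p + q - 1) * (Real.Gamma p * Real.Gamma q / Real.Gamma (p + q)) := by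
  have h1 := Complex.betaIntegral_scaled (p : ℂ) (q : ℂ) hL
  have h2 := Complex.Gamma_mul_Gamma_eq_betaIntegral (s := (p : ℂ)) (t := (q : ℂ))
    (by simpa using hp) (by simpa using hq)
  have hG : Real.Gamma (p + q) ≠ 0 := (Real.Gamma_pos_of_pos (by linarith)).ne'
  have hGc : Complex.Gamma ((p : ℂ) + q) = ((Real.Gamma (p + q) : ℝ) : ℂ) := by
    rw [← Complex.Gamma_ofReal]; push_cast; rfl
  have h3 : Complex.betaIntegral p q
      = ((Real.Gamma p * Real.Gamma q / Real.Gamma (p + q) : ℝ) : ℂ) := by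
    rw [hGc, Complex.Gamma_ofReal, Complex.Gamma_ofReal] at h2
    push_cast
    rw [h2]
    have hG' : ((Real.Gamma (p + q) : ℝ) : ℂ) ≠ 0 := by exact_mod_cast hG
    field_simp
  rw [h3] at h1
  have h4 : (L : ℂ) ^ ((p : ℂ) + q - 1) = ((L ^ (p + q - 1) : ℝ) : ℂ) := by
    rw [Complex.ofReal_cpow hL.le]; push_cast; rfl
  rw [h4, intervalIntegral.integral_of_le hL.le, MeasureTheory.integral_Ioc_eq_integral_Ioo] at h1
  have h5 : ∫ x in Set.Ioo 0 L, (x : ℂ) ^ ((p : ℂ) - 1) * ((L : ℂ) - x) ^ ((q : ℂ) - 1)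
      = ∫ x in Set.Ioo 0 L, ((x ^ (p - 1) * (L - x) ^ (q - 1) : ℝ) : ℂ) := by
    apply MeasureTheory.setIntegral_congr_fun measurableSet_Ioo
    intro x hx
    simp only
    push_cast
    rw [Complex.ofReal_cpow hx.1.le, Complex.ofReal_cpow (by linarith [hx.2])]
    push_cast; rfl
  rw [h5, integral_complex_ofReal] at h1
  exact_mod_cast h1

theorem aux_int (b γ A s : ℝ) (hγ : 0 < γ) (hA : A < 1) (hs : 0 < s) (hsb : s < b) :
    ∫ τ in s..b, (Real.log (τ / s)) ^ (-A) *
        ((Real.log (b / τ)) ^ γ - (Real.log (b / b)) ^ γ) / τ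
      = Real.log (b / s) ^ (γ + 1 - A) *
        (Real.Gamma (1 - A) * Real.Gamma (γ + 1) / Real.Gamma (γ + 2 - A)) := by
  have hb : 0 < b := hs.trans hsb
  have hL : 0 < Real.log (b / s) := Real.log_pos ((one_lt_div hs).2 hsb)
  set L := Real.log (b / s) with hLdef
  have hbs : b = s * Real.exp L := by
    rw [hLdef, Real.exp_log (by positivity)]; field_simp
  have himg : (fun u => s * Real.exp u) '' Set.Ioo 0 L = Set.Ioo s b := by
    ext y
    constructor
    · rintro ⟨u, ⟨h1, h2⟩, rfl⟩
      refine ⟨?_, ?_⟩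
      · have := Real.one_lt_exp_iff.2 h1
        simp only
        nlinarith
      · rw [hbs]
        have := Real.exp_lt_exp.2 h2
        simp only
        nlinarith
    · rintro ⟨h1, h2⟩
      refine ⟨Real.log (y / s), ⟨Real.log_pos ((one_lt_div hs).2 h1), ?_⟩, ?_⟩
      · exact Real.log_lt_log (div_pos (hs.trans h1) hs) (by gcongr)
      · simp only
        rw [Real.exp_log (div_pos (hs.trans h1) hs)]; field_simp
  rw [intervalIntegral.integral_of_le hsb.le, MeasureTheory.integral_Ioc_eq_integral_Ioo, ← himg,
    MeasureTheory.integral_image_eq_integral_abs_deriv_smul (f' := fun u => s * Real.exp u)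
      measurableSet_Ioo
      (fun u _ => ((Real.hasDerivAt_exp u).const_mul s).hasDerivWithinAt)
      (fun u _ v _ h => by
        have h' : s * Real.exp u = s * Real.exp v := h
        exact Real.exp_injective (mul_left_cancel₀ hs.ne' h'))]
  have := aux_beta (1 - A) (γ + 1) L (by linarith) (by linarith) hL
  rw [show 1 - A + (γ + 1) - 1 = γ + 1 - A by ring, show 1 - A + (γ + 1) = γ + 2 - A by ring] at this
  rw [← this]
  apply MeasureTheory.setIntegral_congr_fun measurableSet_Ioo
  intro u hu
  have hpos : 0 < s * Real.exp u := by positivity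
  have e1 : s * Real.exp u / s = Real.exp u := by field_simp
  have e2 : b / (s * Real.exp u) = Real.exp (L - u) := by
    rw [hbs, Real.exp_sub]; field_simp
  simp only [smul_eq_mul]
  rw [abs_of_pos hpos, e1, e2, Real.log_exp, Real.log_exp, div_self hb.ne', Real.log_one,
    Real.zero_rpow hγ.ne', show 1 - A - 1 = -A by ring, show γ + 1 - 1 = γ by ring]
  field_simp
  ring

/-- the value of the right Caputo–Hadamard derivative of variable order,
type 3, of `x(t) = (ln(b/t))^γ`. -/
theorem caputoHadamard_right_type3_log_rpow
    (a b γ : ℝ) (ha : 0 < a) (hab : a < b) (hγ : 0 < γ) (α : ℝ → ℝ)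
    (hα : ∀ s, α s ∈ Set.Ioo (0 : ℝ) 1) (hαd : Differentiable ℝ α)
    (t : ℝ) (ht : t ∈ Set.Ico a b) :
    CHD3r b α (fun s : ℝ => (Real.log (b / s)) ^ γ) t
      = Real.Gamma (γ + 1) / Real.Gamma (γ + 1 - α t) *
          (Real.log (b / t)) ^ (γ - α t)
        + (t * deriv α t * Real.Gamma (γ + 1) / Real.Gamma (γ + 2 - α t)) *
            (Real.log (b / t)) ^ (γ + 1 - α t) *
            (Real.log (Real.log (b / t)) - digamma (γ + 2 - α t)) := by
  have ht0 : 0 < t := ha.trans_le ht.1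
  have hb : 0 < b := ha.trans hab
  have hL : 0 < Real.log (b / t) := Real.log_pos ((one_lt_div ht0).2 ht.2)
  have hα1 := (hα t).2
  have heq : (fun s : ℝ => (1 / Real.Gamma (1 - α s)) *
      ∫ τ in s..b, (Real.log (τ / s)) ^ (-(α s)) *
        ((Real.log (b / τ)) ^ γ - (Real.log (b / b)) ^ γ) / τ)
      =ᶠ[nhds t] fun s => Real.Gamma (γ + 1) *
        (Real.log (b / s) ^ (γ + 1 - α s) / Real.Gamma (γ + 2 - α s)) := by
    filter_upwards [Ioo_mem_nhds ht0 ht.2] with s hs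
    rw [aux_int b γ (α s) s hγ (hα s).2 hs.1 hs.2]
    have h1 : Real.Gamma (1 - α s) ≠ 0 :=
      (Real.Gamma_pos_of_pos (by linarith [(hα s).2])).ne'
    field_simp
  have hG2 : 0 < Real.Gamma (γ + 2 - α t) := Real.Gamma_pos_of_pos (by linarith)
  have hG1 : 0 < Real.Gamma (γ + 1 - α t) := Real.Gamma_pos_of_pos (by linarith)
  have hrec : Real.Gamma (γ + 2 - α t) = (γ + 1 - α t) * Real.Gamma (γ + 1 - α t) := by
    rw [← Real.Gamma_add_one (by linarith)]; congr 1; ring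
  have hαt := (hαd t).hasDerivAt
  have hlog : HasDerivAt (fun s => Real.log (b / s)) (-1 / t) t := by
    have h := ((hasDerivAt_inv ht0.ne').const_mul b).log (by positivity)
    have e : -1 / t = b * -(t ^ 2)⁻¹ / (b * t⁻¹) := by field_simp
    rw [e]
    exact h
  have hGd : HasDerivAt (fun s => Real.Gamma (γ + 2 - α s))
      (deriv Real.Gamma (γ + 2 - α t) * (-deriv α t)) t := by
    have hd : DifferentiableAt ℝ Real.Gamma (γ + 2 - α t) :=
      Real.differentiableAt_Gamma (fun m => by
        have : (0 : ℝ) ≤ m := Nat.cast_nonneg m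
        intro h; linarith)
    exact hd.hasDerivAt.comp t (hαt.const_sub (γ + 2))
  have hpow := hlog.rpow (hαt.const_sub (γ + 1)) hL
  have hF := ((hpow.div hGd hG2.ne').const_mul (Real.Gamma (γ + 1))).deriv
  unfold CHD3r
  rw [heq.deriv_eq]
  refine (congrArg (fun z => -t * z) hF).trans ?_
  have hp1 : Real.log (b / t) ^ (γ + 1 - α t - 1) = Real.log (b / t) ^ (γ - α t) := by
    congr 1; ring
  simp only [digamma, hp1]
  generalize Real.log (b / t) ^ (γ - α t) = P at *
  generalize deriv Real.Gamma (γ + 2 - α t) = D at *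
  have hc : γ + 1 - α t ≠ 0 := by linarith
  rw [hrec]
  field_simp
  ring
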